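/- (Deterministic encoder output entropy bound) Let X and Z be finite alphabets, P_X a probability distribution on X, Dic a complete leaf set over X with induced leaf distribution P_D := P_X^Dic, C a complete leaf set over Z, and f : Dic → C any function with pushforward distribution P_Y on C. Then H(P_Y) ≤ H(P_D) = E[ℓ(D)] · H(P_X), where E[ℓ(D)] := Σ_{d ∈ Dic} P_D(d) ℓ(d). -/

import Mathlib

open Finset

noncomputable section

/-- A finite set of nonempty strings over `Z` is a *complete leaf set* if it is
prefix-free and every sufficiently long string over `Z` has exactly one prefix in it
(equivalently, it is the leaf set of a finite rooted tree in which every branching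
node has exactly `|Z|` children, one per letter). -/
def IsCompleteLeafSet {Z : Type*} (L : Finset (List Z)) : Prop :=
  (∀ t ∈ L, t ≠ []) ∧
  (∀ s ∈ L, ∀ t ∈ L, s <+: t → s = t) ∧
  (∃ N : ℕ, ∀ s : List Z, N ≤ s.length → ∃! t, t ∈ L ∧ t <+: s)

/-- The branching set: all proper prefixes of leaves, including the root `[]`. -/
def branchSet {Z : Type*} [DecidableEq Z] (L : Finset (List Z)) : Finset (List Z) :=
  L.biUnion fun t => (Finset.range t.length).image fun i => t.take i

/-- Node probability `Q(t)`: total probability of the leaves having `t` as a prefix. -/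
def nodeProb {Z : Type*} [DecidableEq Z] (L : Finset (List Z)) (P : List Z → ℝ)
    (t : List Z) : ℝ :=
  ∑ s ∈ L.filter (fun s => t <+: s), P s

/-- Branching distribution `P_{Y_t}(z) = Q(tz)/Q(t)` (junk value `0` when `Q(t) = 0`,
so that terms with `Q(t) = 0` vanish). -/
def branchDist {Z : Type*} [DecidableEq Z] (L : Finset (List Z)) (P : List Z → ℝ)
    (t : List Z) (z : Z) : ℝ :=
  nodeProb L P (t ++ [z]) / nodeProb L P t

/-- Expected leaf depth `E[ℓ(Y)]`. -/
def expLen {Z : Type*} (L : Finset (List Z)) (P : List Z → ℝ) : ℝ :=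
  ∑ t ∈ L, P t * t.length

/-- Shannon entropy in bits of `P` on the finite set `S` (terms with `P x = 0` vanish). -/
def ent {α : Type*} (S : Finset α) (P : α → ℝ) : ℝ :=
  ∑ x ∈ S, -(P x * Real.logb 2 (P x))

/-- Informational divergence in bits of `P` from `P'` on `S` (terms with `P x = 0` vanish). -/
def kl {α : Type*} (S : Finset α) (P P' : α → ℝ) : ℝ :=
  ∑ x ∈ S, P x * Real.logb 2 (P x / P' x)

/-- The leaf distribution induced by a memoryless source: `P_Z^L(t) = ∏ i, P_Z(t_i)`. -/
def inducedProb {Z : Type*} (P : Z → ℝ) (t : List Z) : ℝ :=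
  (t.map P).prod

/-- `L¹` (total variation) distance between two distributions on a finite alphabet. -/
def l1dist {Z : Type*} [Fintype Z] (P P' : Z → ℝ) : ℝ :=
  ∑ z, |P z - P' z|

/-- The pushforward of a distribution on the dictionary under an encoding map. -/
def pushf {X Z : Type*} [DecidableEq Z] (Dic : Finset (List X)) (f : List X → List Z)
    (P : List X → ℝ) (c : List Z) : ℝ :=
  ∑ d ∈ Dic.filter (fun d => f d = c), P d

lemma leaf_aux {X : Type*} [Fintype X] [DecidableEq X]
    (PX : X → ℝ) (hXnn : ∀ x : X, 0 ≤ PX x) (hXsum : ∑ x : X, PX x = 1) (N : ℕ) :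
    ∀ L : Finset (List X), (∀ s ∈ L, ∀ t ∈ L, s <+: t → s = t) →
      (∀ s : List X, N ≤ s.length → ∃ t, t ∈ L ∧ t <+: s) →
      (∑ t ∈ L, inducedProb PX t = 1) ∧
      ∑ t ∈ L, inducedProb PX t *
        (Real.logb 2 (inducedProb PX t) + t.length * ent Finset.univ PX) = 0 := by
  have base : ∀ L : Finset (List X), (∀ s ∈ L, ∀ t ∈ L, s <+: t → s = t) → [] ∈ L →
      (∑ t ∈ L, inducedProb PX t = 1) ∧
      ∑ t ∈ L, inducedProb PX t *
        (Real.logb 2 (inducedProb PX t) + t.length * ent Finset.univ PX) = 0 := by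
    intro L hpf h0
    have hL : L = {[]} := by
      ext t
      simp only [Finset.mem_singleton]
      constructor
      · intro ht
        exact (hpf [] h0 t ht (List.nil_prefix)).symm
      · rintro rfl
        exact h0
    subst hL
    simp [inducedProb]
  induction N with
  | zero =>
    intro L hpf hc
    obtain ⟨t, ht, htp⟩ := hc [] (by simp)
    have : t = [] := List.prefix_nil.mp htp
    subst this
    exact base L hpf ht
  | succ N ih =>
    intro L hpf hc
    by_cases h0 : [] ∈ L
    · exact base L hpf h0
    have hinj : ∀ x : X, Function.Injective (List.cons x) := fun x => List.cons_injective
    let S : X → Finset (List X) := fun x => L.preimage (List.cons x) (hinj x).injOn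
    have hS : ∀ x t, t ∈ S x ↔ x :: t ∈ L := fun x t => by simp [S]
    have hL : L = Finset.univ.biUnion (fun x => (S x).image (List.cons x)) := by
      ext t
      simp only [Finset.mem_biUnion, Finset.mem_univ, true_and, Finset.mem_image, hS]
      constructor
      · intro ht
        cases t with
        | nil => exact absurd ht h0
        | cons x t => exact ⟨x, t, ht, rfl⟩
      · rintro ⟨x, t, ht, rfl⟩
        exact ht
    have hsum : ∀ g : List X → ℝ, ∑ t ∈ L, g t = ∑ x, ∑ t ∈ S x, g (x :: t) := by
      intro g
      conv_lhs => rw [hL]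
      rw [Finset.sum_biUnion]
      · refine Finset.sum_congr rfl fun x _ => ?_
        rw [Finset.sum_image]
        exact (hinj x).injOn
      · intro x _ y _ hxy
        simp only [Function.onFun]
        rw [Finset.disjoint_left]
        intro t h1 h2
        simp only [Finset.mem_image] at h1 h2
        obtain ⟨a, _, rfl⟩ := h1
        obtain ⟨b, _, hb⟩ := h2
        exact hxy (List.cons.inj hb).1.symm
    have key := fun x => ih (S x)
      (fun s hs t ht hst => by
        have := hpf _ ((hS x s).1 hs) _ ((hS x t).1 ht) (by simpa using hst)
        exact (List.cons.inj this).2)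
      (fun s hs => by
        obtain ⟨t, ht, htp⟩ := hc (x :: s) (by simpa using hs)
        cases t with
        | nil => exact absurd ht h0
        | cons y t =>
          obtain ⟨rfl, h2⟩ := List.cons_prefix_cons.1 htp
          exact ⟨t, (hS _ _).2 ht, h2⟩)
    have hcons : ∀ x t, inducedProb PX (x :: t) = PX x * inducedProb PX t := by
      intro x t
      simp [inducedProb]
    rw [hsum, hsum]
    constructor
    · rw [← hXsum]
      refine Finset.sum_congr rfl fun x _ => ?_
      simp only [hcons]
      rw [← Finset.mul_sum, (key x).1, mul_one]
    · have : ∀ x, ∑ t ∈ S x, inducedProb PX (x :: t) *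
          (Real.logb 2 (inducedProb PX (x :: t)) +
            ((x :: t).length : ℝ) * ent Finset.univ PX) =
          PX x * Real.logb 2 (PX x) + PX x * ent Finset.univ PX := by
        intro x
        obtain ⟨h1, h2⟩ := key x
        have e : ∀ t, inducedProb PX (x :: t) *
          (Real.logb 2 (inducedProb PX (x :: t)) +
            ((x :: t).length : ℝ) * ent Finset.univ PX) =
          PX x * (inducedProb PX t *
            (Real.logb 2 (inducedProb PX t) + t.length * ent Finset.univ PX)) +
          inducedProb PX t * (PX x * Real.logb 2 (PX x) + PX x * ent Finset.univ PX) := by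
          intro t
          rw [hcons]
          by_cases ha : PX x = 0
          · simp [ha]
          by_cases hb : inducedProb PX t = 0
          · simp [hb]
          rw [Real.logb_mul ha hb]
          push_cast [List.length_cons]
          ring
        rw [Finset.sum_congr rfl fun t _ => e t, Finset.sum_add_distrib, ← Finset.mul_sum,
          ← Finset.sum_mul, h1, h2]
        ring
      rw [Finset.sum_congr rfl fun x _ => this x, Finset.sum_add_distrib, ← Finset.sum_mul,
        hXsum]
      simp [ent]

lemma pushf_ent_le {X Z : Type*} [DecidableEq Z] (Dic : Finset (List X)) (C : Finset (List Z))
    (f : List X → List Z) (hf : ∀ d ∈ Dic, f d ∈ C) (P : List X → ℝ) (hP : ∀ d, 0 ≤ P d) :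
    ent C (pushf Dic f P) ≤ ent Dic P := by
  unfold ent
  rw [← Finset.sum_fiberwise_of_maps_to hf]
  refine Finset.sum_le_sum fun c _ => ?_
  have : -(pushf Dic f P c * Real.logb 2 (pushf Dic f P c)) =
      ∑ d ∈ Dic.filter (fun d => f d = c), -(P d * Real.logb 2 (pushf Dic f P c)) := by
    rw [Finset.sum_neg_distrib, ← Finset.sum_mul]
    rfl
  rw [this]
  refine Finset.sum_le_sum fun d hd => ?_
  rcases (hP d).eq_or_lt with h | h
  · simp [← h]
  have hle : P d ≤ pushf Dic f P c :=
    Finset.single_le_sum (f := P) (fun i _ => hP i) hd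
  have := Real.logb_le_logb_of_le (b := 2) (by norm_num) h hle
  have := mul_le_mul_of_nonneg_left this h.le
  linarith

/-- **Deterministic encoder output entropy bound.**
`H(P_Y) ≤ H(P_D) = E[ℓ(D)] · H(P_X)`. -/
theorem deterministic_encoder_entropy_bound {X Z : Type*}
    [Fintype X] [DecidableEq X] [Fintype Z] [DecidableEq Z]
    (hX : 2 ≤ Fintype.card X) (hZ : 2 ≤ Fintype.card Z)
    (PX : X → ℝ) (hXnn : ∀ x : X, 0 ≤ PX x) (hXsum : ∑ x : X, PX x = 1)
    (Dic : Finset (List X)) (hDic : IsCompleteLeafSet Dic)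
    (C : Finset (List Z)) (hC : IsCompleteLeafSet C)
    (f : List X → List Z) (hf : ∀ d ∈ Dic, f d ∈ C) :
    ent C (pushf Dic f (inducedProb PX)) ≤ ent Dic (inducedProb PX) ∧
    ent Dic (inducedProb PX) = expLen Dic (inducedProb PX) * ent Finset.univ PX := by
  constructor
  · refine pushf_ent_le Dic C f hf _ fun d => ?_
    unfold inducedProb
    apply List.prod_nonneg
    intro a ha
    obtain ⟨x, _, rfl⟩ := List.mem_map.1 ha
    exact hXnn x
  · obtain ⟨_, hpf, N, hN⟩ := hDic
    have h := (leaf_aux PX hXnn hXsum N Dic hpf (fun s hs => (hN s hs).exists)).2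
    simp only [mul_add, Finset.sum_add_distrib, ← mul_assoc] at h
    rw [← Finset.sum_mul] at h
    have h1 : ent Dic (inducedProb PX) =
        -∑ t ∈ Dic, inducedProb PX t * Real.logb 2 (inducedProb PX t) := by
      unfold ent
      rw [Finset.sum_neg_distrib]
    have h2 : expLen Dic (inducedProb PX) = ∑ t ∈ Dic, inducedProb PX t * (t.length : ℝ) := rfl
    rw [h1, h2]
    linarith
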